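/- Reduction of the quasilinear bias to single integrals. For all μ₁, μ₂, α, β ∈ ℝ, σ₁, σ₂ > 0 and ρ ∈ (−1, 1), the double integral ∫_{max(α,−β)}^{∞} [ ∫_{−∞}^{α−u₂} (α − u₂)·𝒩(u₁, u₂) du₁ + ∫_{α−u₂}^{β+u₂} u₁·𝒩(u₁, u₂) du₁ + ∫_{β+u₂}^{∞} (β + u₂)·𝒩(u₁, u₂) du₁ ] du₂ equals ∫_{t₀}^{∞} { (√2·e^{−t²/2}/(4√π))·(erf(γ₁(t)) − 1)·(μ₂ − α + σ₂t) + (σ₁√(1−ρ²)/(2π))·e^{−t²/2}·(e^{−γ₁(t)²} − e^{−γ₂(t)²}) + (√2/(4√π))·(μ₁ + ρσ₁t)·e^{−t²/2}·(erf(γ₁(t)) + erf(γ₂(t))) − (√2·e^{−t²/2}/(4√π))·(erf(γ₂(t)) − 1)·(β + μ₂ + σ₂t) } dt. -/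

import Mathlib

open MeasureTheory

/-- The error function `erf x = (2/√π) ∫₀ˣ e^{−s²} ds`. -/
noncomputable def erf (x : ℝ) : ℝ :=
  (2 / Real.sqrt Real.pi) * ∫ s in (0 : ℝ)..x, Real.exp (-s ^ 2)

/-- The bivariate Gaussian density with means `μ₁, μ₂`, standard deviations `σ₁, σ₂`
and correlation `ρ`. -/
noncomputable def biGauss (μ₁ μ₂ σ₁ σ₂ ρ : ℝ) (u₁ u₂ : ℝ) : ℝ :=
  (1 / (2 * Real.pi * σ₁ * σ₂ * Real.sqrt (1 - ρ ^ 2))) *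
    Real.exp (-(((u₁ - μ₁) / σ₁) ^ 2 + ((u₂ - μ₂) / σ₂) ^ 2
        - 2 * ρ * ((u₁ - μ₁) / σ₁) * ((u₂ - μ₂) / σ₂)) / (2 * (1 - ρ ^ 2)))

/-- `γ₁(t) = √2 (μ₁ − α + μ₂ + (σ₂ + ρσ₁) t) / (2σ₁ √(1−ρ²))`. -/
noncomputable def gamma1 (μ₁ μ₂ σ₁ σ₂ ρ α : ℝ) (t : ℝ) : ℝ :=
  Real.sqrt 2 * (μ₁ - α + μ₂ + (σ₂ + ρ * σ₁) * t) / (2 * σ₁ * Real.sqrt (1 - ρ ^ 2))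

/-- `γ₂(t) = √2 (β − μ₁ + μ₂ + (σ₂ − ρσ₁) t) / (2σ₁ √(1−ρ²))`. -/
noncomputable def gamma2 (μ₁ μ₂ σ₁ σ₂ ρ β : ℝ) (t : ℝ) : ℝ :=
  Real.sqrt 2 * (β - μ₁ + μ₂ + (σ₂ - ρ * σ₁) * t) / (2 * σ₁ * Real.sqrt (1 - ρ ^ 2))

open Filter Topology

lemma hasDerivAt_erf (x : ℝ) :
    HasDerivAt erf (2 / Real.sqrt Real.pi * Real.exp (-x ^ 2)) x := by
  have hc : Continuous fun s : ℝ => Real.exp (-s ^ 2) := by fun_prop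
  exact (intervalIntegral.integral_hasDerivAt_right (hc.intervalIntegrable _ _)
    (hc.stronglyMeasurableAtFilter _ _) hc.continuousAt).const_mul _

lemma erf_neg (x : ℝ) : erf (-x) = -erf x := by
  have h := intervalIntegral.integral_comp_neg (a := 0) (b := x) fun s : ℝ => Real.exp (-s ^ 2)
  simp only [neg_sq, neg_zero] at h
  rw [erf, erf, h, intervalIntegral.integral_symm]
  ring

lemma tendsto_erf_atTop : Tendsto erf atTop (𝓝 1) := by
  have hi : Integrable fun s : ℝ => Real.exp (-s ^ 2) := by
    simpa using integrable_exp_neg_mul_sq one_pos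
  have hv : ∫ s in Set.Ioi (0 : ℝ), Real.exp (-s ^ 2) = Real.sqrt Real.pi / 2 := by
    simpa using integral_gaussian_Ioi 1
  have h := (intervalIntegral_tendsto_integral_Ioi 0 hi.integrableOn tendsto_id).const_mul
    (2 / Real.sqrt Real.pi)
  rw [hv] at h
  have hπ : Real.sqrt Real.pi ≠ 0 := (Real.sqrt_pos.2 Real.pi_pos).ne'
  rwa [div_mul_div_cancel₀ hπ, div_self two_ne_zero] at h

lemma tendsto_erf_atBot : Tendsto erf atBot (𝓝 (-1)) := by
  have h := (tendsto_erf_atTop.comp tendsto_neg_atBot_atTop).neg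
  refine h.congr fun x => ?_
  simp [erf_neg]

section Gaussian

variable {k : ℝ} (m : ℝ)

lemma hasDerivAt_erf_affine (hk : 0 < k) (x : ℝ) :
    HasDerivAt (fun y => k * Real.sqrt Real.pi / 2 * erf ((y - m) / k))
      (Real.exp (-((x - m) / k) ^ 2)) x := by
  have hπ : Real.sqrt Real.pi ≠ 0 := (Real.sqrt_pos.2 Real.pi_pos).ne'
  have h := ((hasDerivAt_erf ((x - m) / k)).comp x
    (((hasDerivAt_id x).sub_const m).div_const k)).const_mul (k * Real.sqrt Real.pi / 2)
  refine h.congr_deriv ?_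
  field_simp

lemma integrable_exp_neg_sq_affine (hk : 0 < k) :
    Integrable fun x => Real.exp (-((x - m) / k) ^ 2) := by
  have hi : Integrable fun s : ℝ => Real.exp (-s ^ 2) := by
    simpa using integrable_exp_neg_mul_sq one_pos
  exact (hi.comp_div hk.ne').comp_sub_right m

lemma integral_Iio_exp_neg_sq_affine (hk : 0 < k) (a : ℝ) :
    ∫ x in Set.Iio a, Real.exp (-((x - m) / k) ^ 2) =
      k * Real.sqrt Real.pi / 2 * (1 + erf ((a - m) / k)) := by
  have ht : Tendsto (fun y => k * Real.sqrt Real.pi / 2 * erf ((y - m) / k)) atBot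
      (𝓝 (k * Real.sqrt Real.pi / 2 * (-1))) :=
    (tendsto_erf_atBot.comp
      ((tendsto_atBot_add_const_right _ (-m) tendsto_id).atBot_div_const hk)).const_mul _
  rw [← integral_Iic_eq_integral_Iio, integral_Iic_of_hasDerivAt_of_tendsto'
    (fun x _ => hasDerivAt_erf_affine m hk x)
    (integrable_exp_neg_sq_affine m hk).integrableOn ht]
  ring

lemma integral_Ioi_exp_neg_sq_affine (hk : 0 < k) (b : ℝ) :
    ∫ x in Set.Ioi b, Real.exp (-((x - m) / k) ^ 2) =
      k * Real.sqrt Real.pi / 2 * (1 - erf ((b - m) / k)) := by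
  have ht : Tendsto (fun y => k * Real.sqrt Real.pi / 2 * erf ((y - m) / k)) atTop
      (𝓝 (k * Real.sqrt Real.pi / 2 * 1)) :=
    (tendsto_erf_atTop.comp
      ((tendsto_atTop_add_const_right _ (-m) tendsto_id).atTop_div_const hk)).const_mul _
  rw [integral_Ioi_of_hasDerivAt_of_tendsto'
    (fun x _ => hasDerivAt_erf_affine m hk x)
    (integrable_exp_neg_sq_affine m hk).integrableOn ht]
  ring

lemma integral_id_mul_exp_neg_sq_affine (hk : 0 < k) (a b : ℝ) :
    ∫ x in a..b, x * Real.exp (-((x - m) / k) ^ 2) =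
      m * (k * Real.sqrt Real.pi / 2) * (erf ((b - m) / k) - erf ((a - m) / k)) +
        k ^ 2 / 2 * (Real.exp (-((a - m) / k) ^ 2) - Real.exp (-((b - m) / k) ^ 2)) := by
  have hd : ∀ x ∈ Set.uIcc a b, HasDerivAt
      (fun y => m * (k * Real.sqrt Real.pi / 2 * erf ((y - m) / k)) -
        k ^ 2 / 2 * Real.exp (-((y - m) / k) ^ 2)) (x * Real.exp (-((x - m) / k) ^ 2)) x := by
    intro x _
    have h := ((hasDerivAt_erf_affine m hk x).const_mul m).sub
      (((((hasDerivAt_id x).sub_const m).div_const k).pow 2).neg.exp.const_mul (k ^ 2 / 2))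
    refine h.congr_deriv ?_
    simp
    field_simp
    ring
  rw [intervalIntegral.integral_eq_sub_of_hasDerivAt hd
    (Continuous.intervalIntegrable (by fun_prop) _ _)]
  ring

end Gaussian

lemma setIntegral_Ioi_eq_comp_affine (F : ℝ → ℝ) (c μ : ℝ) {σ : ℝ} (hσ : 0 < σ) :
    ∫ u in Set.Ioi c, F u = ∫ t in Set.Ioi ((c - μ) / σ), σ * F (μ + σ * t) := by
  have himg : (fun t => μ + σ * t) '' Set.Ioi ((c - μ) / σ) = Set.Ioi c := by
    ext u
    simp only [Set.mem_image, Set.mem_Ioi]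
    constructor
    · rintro ⟨t, ht, rfl⟩
      rw [div_lt_iff₀ hσ] at ht
      linarith
    · intro hu
      exact ⟨(u - μ) / σ, by gcongr, by field_simp; ring⟩
  have hd : ∀ t ∈ Set.Ioi ((c - μ) / σ), HasDerivWithinAt (fun t => μ + σ * t) σ
      (Set.Ioi ((c - μ) / σ)) t := fun t _ => by
    simpa using (((hasDerivAt_id t).const_mul σ).const_add μ).hasDerivWithinAt
  have hinj : Set.InjOn (fun t => μ + σ * t) (Set.Ioi ((c - μ) / σ)) := fun x _ y _ h => by
    simpa [hσ.ne'] using h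
  rw [← himg, integral_image_eq_integral_abs_deriv_smul measurableSet_Ioi hd hinj]
  simp [abs_of_pos hσ]

lemma biGauss_eq_conditional {μ₁ μ₂ σ₁ σ₂ ρ : ℝ} (hσ₁ : 0 < σ₁) (hσ₂ : 0 < σ₂)
    (hρ : 0 < 1 - ρ ^ 2) (u t : ℝ) :
    biGauss μ₁ μ₂ σ₁ σ₂ ρ u (μ₂ + σ₂ * t) =
      Real.exp (-t ^ 2 / 2) / (2 * Real.pi * σ₁ * σ₂ * Real.sqrt (1 - ρ ^ 2)) *
        Real.exp (-((u - (μ₁ + ρ * σ₁ * t)) /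
          (σ₁ * Real.sqrt (1 - ρ ^ 2) * Real.sqrt 2)) ^ 2) := by
  have h2 : Real.sqrt 2 ^ 2 = 2 := Real.sq_sqrt (by norm_num)
  have hr : Real.sqrt (1 - ρ ^ 2) ^ 2 = 1 - ρ ^ 2 := Real.sq_sqrt hρ.le
  rw [biGauss, one_div_mul_eq_div, div_mul_eq_mul_div, ← Real.exp_add]
  congr 2
  rw [div_pow (u - (μ₁ + ρ * σ₁ * t)), mul_pow, mul_pow, h2, hr]
  field_simp
  ring

/-- **Reduction of the quasilinear bias to single integrals.** -/
theorem bias_single_integral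
    (μ₁ μ₂ σ₁ σ₂ ρ α β : ℝ) (hσ₁ : 0 < σ₁) (hσ₂ : 0 < σ₂)
    (hρ : ρ ∈ Set.Ioo (-1 : ℝ) 1) :
    (∫ u₂ in Set.Ioi (max α (-β)),
        ((∫ u₁ in Set.Iio (α - u₂), (α - u₂) * biGauss μ₁ μ₂ σ₁ σ₂ ρ u₁ u₂) +
         (∫ u₁ in (α - u₂)..(β + u₂), u₁ * biGauss μ₁ μ₂ σ₁ σ₂ ρ u₁ u₂) +
         (∫ u₁ in Set.Ioi (β + u₂), (β + u₂) * biGauss μ₁ μ₂ σ₁ σ₂ ρ u₁ u₂))) =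
      ∫ t in Set.Ioi ((max α (-β) - μ₂) / σ₂),
        (Real.sqrt 2 * Real.exp (-t ^ 2 / 2) / (4 * Real.sqrt Real.pi) *
            (erf (gamma1 μ₁ μ₂ σ₁ σ₂ ρ α t) - 1) * (μ₂ - α + σ₂ * t)
         + σ₁ * Real.sqrt (1 - ρ ^ 2) / (2 * Real.pi) * Real.exp (-t ^ 2 / 2) *
            (Real.exp (-(gamma1 μ₁ μ₂ σ₁ σ₂ ρ α t) ^ 2)
              - Real.exp (-(gamma2 μ₁ μ₂ σ₁ σ₂ ρ β t) ^ 2))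
         + Real.sqrt 2 / (4 * Real.sqrt Real.pi) * (μ₁ + ρ * σ₁ * t) *
            Real.exp (-t ^ 2 / 2) *
            (erf (gamma1 μ₁ μ₂ σ₁ σ₂ ρ α t) + erf (gamma2 μ₁ μ₂ σ₁ σ₂ ρ β t))
         - Real.sqrt 2 * Real.exp (-t ^ 2 / 2) / (4 * Real.sqrt Real.pi) *
            (erf (gamma2 μ₁ μ₂ σ₁ σ₂ ρ β t) - 1) * (β + μ₂ + σ₂ * t)) := by
  obtain ⟨hρ₁, hρ₂⟩ := hρ
  have hρ : 0 < 1 - ρ ^ 2 := by nlinarith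
  rw [setIntegral_Ioi_eq_comp_affine _ _ μ₂ hσ₂]
  congr 1
  funext t
  have hs : 0 < Real.sqrt (1 - ρ ^ 2) := Real.sqrt_pos.2 hρ
  have h2 : 0 < Real.sqrt 2 := by positivity
  have hπ : 0 < Real.sqrt Real.pi := Real.sqrt_pos.2 Real.pi_pos
  have hk : 0 < σ₁ * Real.sqrt (1 - ρ ^ 2) * Real.sqrt 2 := by positivity
  have h2' : Real.sqrt 2 ^ 2 = 2 := Real.sq_sqrt (by norm_num)
  have hπ' : Real.pi = Real.sqrt Real.pi ^ 2 := (Real.sq_sqrt Real.pi_pos.le).symm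
  have hγ₁ : (α - (μ₂ + σ₂ * t) - (μ₁ + ρ * σ₁ * t)) /
      (σ₁ * Real.sqrt (1 - ρ ^ 2) * Real.sqrt 2) = -gamma1 μ₁ μ₂ σ₁ σ₂ ρ α t := by
    rw [gamma1]
    field_simp
    rw [h2']
    ring
  have hγ₂ : (β + (μ₂ + σ₂ * t) - (μ₁ + ρ * σ₁ * t)) /
      (σ₁ * Real.sqrt (1 - ρ ^ 2) * Real.sqrt 2) = gamma2 μ₁ μ₂ σ₁ σ₂ ρ β t := by
    rw [gamma2]
    field_simp
    rw [h2']
    ring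
  simp only [biGauss_eq_conditional hσ₁ hσ₂ hρ, mul_left_comm _ (_ / _) (Real.exp _),
    integral_const_mul, intervalIntegral.integral_const_mul]
  rw [integral_Iio_exp_neg_sq_affine _ hk, integral_Ioi_exp_neg_sq_affine _ hk,
    integral_id_mul_exp_neg_sq_affine _ hk, hγ₁, hγ₂, erf_neg, neg_sq]
  generalize gamma1 μ₁ μ₂ σ₁ σ₂ ρ α t = g₁
  generalize gamma2 μ₁ μ₂ σ₁ σ₂ ρ β t = g₂
  generalize Real.exp (-t ^ 2 / 2) = E
  rw [hπ']
  simp only [Real.sqrt_sq hπ.le]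
  generalize Real.sqrt Real.pi = p at *
  generalize Real.sqrt (1 - ρ ^ 2) = r at *
  generalize Real.sqrt 2 = q at *
  field_simp
  ring_nf
  simp only [h2']
  ring
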